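/- Let (m_n)_{n≥1} be a sequence of integers with m_n ≥ 2 and m_n → ∞, and set t_n = (3·log n)/(2·log m_n). Then lim_{n→∞} min{‖Q_{n,m_n}^{k} − U_n‖_TV : k integer, 0 ≤ k < {t_n}} = 1 and lim_{n→∞} sup{‖Q_{n,m_n}^{k} − U_n‖_TV : k integer, k > {t_n}} = 0. -/

import Mathlib

open Filter MeasureTheory
open scoped BigOperators NNReal ENNReal

noncomputable section

/-- The value of `σ⁻¹` at position `i` (0-indexed), as a natural number; `0` out of range. -/
def invAt (n : ℕ) (σ : Equiv.Perm (Fin n)) (i : ℕ) : ℕ :=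
  if h : i < n then ((σ⁻¹ ⟨i, h⟩ : Fin n) : ℕ) else 0

/-- The number of rising sequences of a permutation: one plus the number of descents
of its inverse. -/
def rSeq (n : ℕ) (σ : Equiv.Perm (Fin n)) : ℕ :=
  1 + ((Finset.range (n - 1)).filter fun i => invAt n σ (i + 1) < invAt n σ i).card

/-- The `m`-shuffle distribution on `S_n`:  `Q_{n,m}(σ) = m^{-n} C(n + m - r(σ), n)`. -/
def Qs (n m : ℕ) (σ : Equiv.Perm (Fin n)) : ℝ :=
  ((m : ℝ) ^ n)⁻¹ * (Nat.choose (n + m - rSeq n σ) n : ℝ)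

/-- The uniform distribution on `S_n`. -/
def Us (n : ℕ) (_ : Equiv.Perm (Fin n)) : ℝ := (n.factorial : ℝ)⁻¹

/-- Total variation distance between two probability distributions on `S_n`. -/
def tv (n : ℕ) (μ ν : Equiv.Perm (Fin n) → ℝ) : ℝ :=
  (1 / 2) * ∑ σ : Equiv.Perm (Fin n), |μ σ - ν σ|

/-- Convolution of two distributions on `S_n`. -/
def convol (n : ℕ) (μ ν : Equiv.Perm (Fin n) → ℝ) : Equiv.Perm (Fin n) → ℝ :=
  fun σ => ∑ τ : Equiv.Perm (Fin n), μ (σ * τ⁻¹) * ν τ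

/-- `k`-fold convolution power; the `0`-th power is the point mass at the identity. -/
def iterConv (n : ℕ) (μ : Equiv.Perm (Fin n) → ℝ) : ℕ → Equiv.Perm (Fin n) → ℝ
  | 0 => fun σ => if σ = 1 then 1 else 0
  | k + 1 => convol n μ (iterConv n μ k)

/-- `Ψ(x) = (2π)^{-1/2} ∫_{-x/(4√3)}^{x/(4√3)} e^{-t²/2} dt`. -/
def Psi (x : ℝ) : ℝ :=
  (Real.sqrt (2 * Real.pi))⁻¹ *
    ∫ t in (-(x / (4 * Real.sqrt 3)))..(x / (4 * Real.sqrt 3)), Real.exp (-t ^ 2 / 2)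

/-- The `p`-shuffle distribution on `S_n` for a probability `p` on the positive integers. -/
def Qp (n : ℕ) (p : ℕ → ℝ) (σ : Equiv.Perm (Fin n)) : ℝ := ∑' m : ℕ, p m * Qs n m σ

/-- `{t}`: the nearest integer to `t` (rounding half up), except `{t} = 1/2` for `0 < t < 1/2`. -/
def curly (t : ℝ) : ℝ := if t < 1 / 2 then 1 / 2 else ((round t : ℤ) : ℝ)

/-- `d(t) = 1/2` for `0 < t < 1/2` and `d(t) = t - {t}` for `t ≥ 1/2`. -/
def dOf (t : ℝ) : ℝ := if t < 1 / 2 then 1 / 2 else t - ((round t : ℤ) : ℝ)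

/-- The number of ascents of `σ⁻¹` strictly before position `i`. -/
def ascBefore (n : ℕ) (σ : Equiv.Perm (Fin n)) (i : ℕ) : ℕ :=
  ((Finset.range i).filter fun j => ¬ invAt n σ (j + 1) < invAt n σ j).card

lemma ascBefore_succ (n : ℕ) (σ : Equiv.Perm (Fin n)) (i : ℕ) :
    ascBefore n σ (i + 1) =
      ascBefore n σ i + if invAt n σ (i + 1) < invAt n σ i then 0 else 1 := by
  unfold ascBefore
  rw [Finset.range_add_one, Finset.filter_insert]
  split_ifs with h <;> simp

lemma ascBefore_mono (n : ℕ) (σ : Equiv.Perm (Fin n)) : Monotone (ascBefore n σ) :=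
  monotone_nat_of_le_succ fun i => by rw [ascBefore_succ]; omega

lemma ascBefore_le_add (n : ℕ) (σ : Equiv.Perm (Fin n)) (i j : ℕ) :
    ascBefore n σ (i + j) ≤ ascBefore n σ i + j := by
  induction j with
  | zero => simp
  | succ j ih =>
    rw [← add_assoc, ascBefore_succ]
    split_ifs <;> omega

lemma rSeq_add_ascBefore (k : ℕ) (σ : Equiv.Perm (Fin (k + 1))) :
    rSeq (k + 1) σ + ascBefore (k + 1) σ k = k + 1 := by
  have h := Finset.card_filter_add_card_filter_not (s := Finset.range k)
    (fun i => invAt (k + 1) σ (i + 1) < invAt (k + 1) σ i)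
  rw [Finset.card_range] at h
  simp only [rSeq, ascBefore, Nat.add_sub_cancel]
  omega

lemma inv_eq_sort_iff_strictMono {k m : ℕ} (σ : Equiv.Perm (Fin (k + 1)))
    (w : Fin (k + 1) → Fin m) :
    σ⁻¹ = Tuple.sort w ↔
      StrictMono fun i : Fin (k + 1) => (w (σ⁻¹ i) : ℕ) + ascBefore (k + 1) σ i := by
  rw [Tuple.eq_sort_iff', Fin.strictMono_iff_lt_succ, Fin.strictMono_iff_lt_succ]
  refine forall_congr' fun i => ?_
  have h1 : invAt (k + 1) σ (i + 1) = (σ⁻¹ i.succ : Fin (k + 1)) := by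
    simp only [invAt]; rw [dif_pos (by omega)]; rfl
  have h2 : invAt (k + 1) σ i = (σ⁻¹ i.castSucc : Fin (k + 1)) := by
    simp only [invAt]; rw [dif_pos (by omega)]; rfl
  have h3 : σ⁻¹ i.castSucc ≠ σ⁻¹ i.succ := by
    simp [(Fin.castSucc_lt_succ (i := i)).ne]
  have h4 : (σ⁻¹.trans (Tuple.graphEquiv₁ w)) i.castSucc <
      (σ⁻¹.trans (Tuple.graphEquiv₁ w)) i.succ ↔
      toLex (w (σ⁻¹ i.castSucc), σ⁻¹ i.castSucc) < toLex (w (σ⁻¹ i.succ), σ⁻¹ i.succ) := Iff.rfl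
  rw [h4, Prod.Lex.toLex_lt_toLex]
  simp only [Fin.val_succ, Fin.val_castSucc, ascBefore_succ, h1, h2]
  rw [Fin.ext_iff, Fin.lt_def, Fin.lt_def]
  rw [Ne, Fin.ext_iff] at h3
  split_ifs with h <;> omega

lemma val_add_le_of_strictMono {k N : ℕ} {h : Fin (k + 1) → Fin N} (hh : StrictMono h)
    {i j : Fin (k + 1)} (hij : i ≤ j) : (h i : ℕ) + j ≤ (h j : ℕ) + i := by
  induction j using Fin.induction with
  | zero => simp [Fin.le_zero_iff.1 hij]
  | succ j ih =>
    rcases hij.eq_or_lt with rfl | hlt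
    · rfl
    have h1 := hh (Fin.castSucc_lt_succ (i := j))
    have h2 := ih (Fin.le_castSucc_iff.2 hlt)
    rw [Fin.lt_def] at h1
    simp only [Fin.val_succ, Fin.val_castSucc] at *
    omega

lemma ascBefore_le_of_strictMono {k N : ℕ} (σ : Equiv.Perm (Fin (k + 1)))
    {h : Fin (k + 1) → Fin N} (hh : StrictMono h) (i : Fin (k + 1)) :
    ascBefore (k + 1) σ i ≤ h i := by
  have h1 := ascBefore_le_add (k + 1) σ 0 i
  have h2 := val_add_le_of_strictMono hh (Fin.zero_le i)
  have h3 : ascBefore (k + 1) σ 0 = 0 := by simp [ascBefore]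
  simp only [Fin.val_zero, zero_add] at *
  omega

/-- The words sorted by `σ⁻¹` correspond to strictly increasing maps. -/
def sortedWordsEquiv {k m : ℕ} (σ : Equiv.Perm (Fin (k + 1))) :
    {w : Fin (k + 1) → Fin m // σ⁻¹ = Tuple.sort w} ≃
      (Fin (k + 1) ↪o Fin (k + 1 + m - rSeq (k + 1) σ)) where
  toFun w := OrderEmbedding.ofStrictMono
    (fun i => ⟨(w.1 (σ⁻¹ i) : ℕ) + ascBefore (k + 1) σ i, by
      have h1 := rSeq_add_ascBefore k σ
      have h2 := (w.1 (σ⁻¹ i)).2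
      have h3 := ascBefore_mono (k + 1) σ (show (i : ℕ) ≤ k by omega)
      omega⟩)
    fun _ _ hij => (inv_eq_sort_iff_strictMono σ w.1).1 w.2 hij
  invFun h := ⟨fun p => ⟨(h (σ p) : ℕ) - ascBefore (k + 1) σ (σ p), by
      have h1 := rSeq_add_ascBefore k σ
      have h2 := ascBefore_le_of_strictMono σ h.strictMono (σ p)
      have h3 := val_add_le_of_strictMono h.strictMono (Fin.le_last (σ p))
      have h4 := ascBefore_le_add (k + 1) σ (σ p) (k - σ p)
      have h5 := (h (Fin.last k)).2
      have h6 := (σ p).2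
      rw [show (σ p : ℕ) + (k - σ p) = k by omega] at h4
      rw [Fin.val_last] at h3
      omega⟩, by
      rw [inv_eq_sort_iff_strictMono]
      intro i j hij
      have h1 := ascBefore_le_of_strictMono σ h.strictMono i
      have h2 := ascBefore_le_of_strictMono σ h.strictMono j
      have h3 := Fin.lt_def.1 (h.strictMono hij)
      have h4 : ∀ x, σ (σ⁻¹ x) = x := fun x => by simp
      simp only [h4]
      omega⟩
  left_inv w := by
    ext p
    simp
  right_inv h := by
    ext i
    simpa using Nat.sub_add_cancel (ascBefore_le_of_strictMono σ h.strictMono i)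

lemma card_sort_eq (k m : ℕ) (σ : Equiv.Perm (Fin (k + 1))) :
    Fintype.card {w : Fin (k + 1) → Fin m // σ⁻¹ = Tuple.sort w} =
      Nat.choose (k + 1 + m - rSeq (k + 1) σ) (k + 1) := by
  rw [Fintype.card_congr ((sortedWordsEquiv σ).trans Set.powersetCard.ofFinEmbEquiv),
    ← Nat.card_eq_fintype_card, Set.powersetCard.card, Nat.card_eq_fintype_card, Fintype.card_fin]

lemma Qs_eq_card (k m : ℕ) (σ : Equiv.Perm (Fin (k + 1))) :
    Qs (k + 1) m σ = ((m : ℝ) ^ (k + 1))⁻¹ *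
      (Fintype.card {w : Fin (k + 1) → Fin m // σ⁻¹ = Tuple.sort w} : ℝ) := by
  rw [card_sort_eq, Qs]

lemma sum_Qs (k m : ℕ) (hm : m ≠ 0) : ∑ σ, Qs (k + 1) m σ = 1 := by
  simp only [Qs_eq_card, ← Finset.mul_sum]
  rw [← Nat.cast_sum, ← Fintype.card_sigma]
  have e : (Σ σ : Equiv.Perm (Fin (k + 1)),
      {w : Fin (k + 1) → Fin m // σ⁻¹ = Tuple.sort w}) ≃ (Fin (k + 1) → Fin m) :=
    ((Equiv.inv _).sigmaCongrLeft (β := fun σ =>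
      {w : Fin (k + 1) → Fin m // σ = Tuple.sort w})).trans
      ((Equiv.sigmaCongrRight fun σ => Equiv.subtypeEquivRight fun w => eq_comm).trans
        (Equiv.sigmaFiberEquiv fun w : Fin (k + 1) → Fin m => Tuple.sort w))
  rw [Fintype.card_congr e]
  have : (m : ℝ) ≠ 0 := by exact_mod_cast hm
  simp [this]

lemma Qs_nonneg (n m : ℕ) (σ : Equiv.Perm (Fin n)) : 0 ≤ Qs n m σ := by
  unfold Qs; positivity

lemma sort_comp_orderIso {n : ℕ} {α β : Type*} [LinearOrder α] [LinearOrder β] (e : α ≃o β)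
    (w : Fin n → α) : Tuple.sort (e ∘ w) = Tuple.sort w := by
  rw [Tuple.eq_sort_iff]
  obtain ⟨h1, h2⟩ := Tuple.eq_sort_iff.1 (rfl : Tuple.sort (e ∘ w) = Tuple.sort (e ∘ w))
  refine ⟨fun i j hij => ?_, fun i j hij h => h2 i j hij (by simp [h])⟩
  simpa using h1 hij

/-- Sorting a word of pairs lexicographically: stably sort by the second word,
then by the first. -/
lemma sort_toLex {n : ℕ} {α β : Type*} [LinearOrder α] [LinearOrder β]
    (u : Fin n → α) (v : Fin n → β) :
    Tuple.sort (fun p => toLex (u ((Tuple.sort v)⁻¹ p), v p)) = Tuple.sort v * Tuple.sort u := by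
  obtain ⟨hu1, hu2⟩ := Tuple.eq_sort_iff.1 (rfl : Tuple.sort u = Tuple.sort u)
  obtain ⟨hv1, hv2⟩ := Tuple.eq_sort_iff.1 (rfl : Tuple.sort v = Tuple.sort v)
  have hinv : ∀ x, (Tuple.sort v)⁻¹ (Tuple.sort v x) = x := fun x => by simp
  symm
  rw [Tuple.eq_sort_iff]
  constructor
  · intro i j hij
    simp only [Function.comp_apply, Equiv.Perm.mul_apply, hinv,
      Prod.Lex.toLex_le_toLex]
    rcases hij.eq_or_lt with rfl | hlt
    · simp
    rcases (hu1 hij).lt_or_eq with h | h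
    · exact Or.inl h
    · exact Or.inr ⟨h, hv1 (hu2 i j hlt h).le⟩
  · intro i j hij h
    simp only [Equiv.Perm.mul_apply, hinv, EmbeddingLike.apply_eq_iff_eq,
      Prod.mk.injEq] at h
    exact hv2 _ _ (hu2 i j hij h.1) h.2

/-- Pairs of words sorted by prescribed permutations give words of pairs. -/
def pairWordsEquiv {n : ℕ} {α β : Type*} [LinearOrder α] [LinearOrder β] :
    (Fin n → α) × (Fin n → β) ≃ (Fin n → α ×ₗ β) where
  toFun x p := toLex (x.1 ((Tuple.sort x.2)⁻¹ p), x.2 p)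
  invFun w := (fun p => (ofLex (w (Tuple.sort (fun q => (ofLex (w q)).2) p))).1,
    fun p => (ofLex (w p)).2)
  left_inv x := by
    ext p <;> simp
  right_inv w := by
    ext p : 1
    simp

lemma card_sort_convolution {n : ℕ} (a b : ℕ) (σ : Equiv.Perm (Fin n)) :
    Fintype.card {w : Fin n → Fin (a * b) // σ⁻¹ = Tuple.sort w} =
      ∑ τ : Equiv.Perm (Fin n),
        Fintype.card {u : Fin n → Fin a // (σ * τ⁻¹)⁻¹ = Tuple.sort u} *
        Fintype.card {v : Fin n → Fin b // τ⁻¹ = Tuple.sort v} := by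
  have e : Fin a ×ₗ Fin b ≃o Fin (a * b) :=
    (Fintype.orderIsoFinOfCardEq _ (by
      rw [← Fintype.card_congr (toLex : Fin a × Fin b ≃ Fin a ×ₗ Fin b)]; simp)).symm
  have e1 : {w : Fin n → Fin (a * b) // σ⁻¹ = Tuple.sort w} ≃
      {x : (Fin n → Fin a) × (Fin n → Fin b) //
        σ⁻¹ = Tuple.sort x.2 * Tuple.sort x.1} := by
    refine (((pairWordsEquiv (n := n)).trans (Equiv.arrowCongr (Equiv.refl _) e.toEquiv)).subtypeEquiv
      fun x => ?_).symm
    rw [← sort_toLex, ← sort_comp_orderIso e]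
    rfl
  rw [Fintype.card_congr e1]
  simp only [← Fintype.card_prod]
  rw [← Fintype.card_sigma]
  refine Fintype.card_congr ?_
  exact
    { toFun := fun x => ⟨(Tuple.sort x.1.2)⁻¹, ⟨x.1.1, by simp [x.2]⟩, ⟨x.1.2, by simp⟩⟩
      invFun := fun y => ⟨(y.2.1.1, y.2.2.1), by
        rw [← y.2.1.2, ← y.2.2.2]; simp⟩
      left_inv := fun x => rfl
      right_inv := by
        rintro ⟨τ, ⟨u, hu⟩, ⟨v, hv⟩⟩
        obtain rfl : τ = (Tuple.sort v)⁻¹ := by rw [← hv, inv_inv]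
        rfl }

lemma convol_Qs (k a b : ℕ) :
    convol (k + 1) (Qs (k + 1) a) (Qs (k + 1) b) = Qs (k + 1) (a * b) := by
  ext σ
  simp only [convol, Qs_eq_card]
  rw [card_sort_convolution, Nat.cast_sum, Finset.mul_sum]
  refine Finset.sum_congr rfl fun τ _ => ?_
  push_cast
  rw [mul_pow, mul_inv]
  ring

lemma Qs_one (k : ℕ) (σ : Equiv.Perm (Fin (k + 1))) :
    Qs (k + 1) 1 σ = if σ = 1 then 1 else 0 := by
  rw [Qs_eq_card]
  have h : ∀ w : Fin (k + 1) → Fin 1, Tuple.sort w = 1 := fun w =>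
    Tuple.sort_eq_refl_iff_monotone.2 fun i j _ => (Subsingleton.elim _ _).le
  simp only [h, inv_eq_one]
  split_ifs with hσ <;> simp [hσ]

lemma iterConv_Qs (k m j : ℕ) : iterConv (k + 1) (Qs (k + 1) m) j = Qs (k + 1) (m ^ j) := by
  induction j with
  | zero => ext σ; simp [iterConv, Qs_one]
  | succ j ih => rw [iterConv, ih, convol_Qs, pow_succ']

/-- The sign of the step from `i` to `i + 1` in `σ⁻¹`: `-1` at a descent and `1` otherwise. -/
def stepSign (n : ℕ) (σ : Equiv.Perm (Fin n)) (i : ℕ) : ℝ :=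
  if invAt n σ (i + 1) < invAt n σ i then -1 else 1

lemma sum_stepSign (k : ℕ) (σ : Equiv.Perm (Fin (k + 1))) :
    ∑ i ∈ Finset.range k, stepSign (k + 1) σ i = (k : ℝ) + 2 - 2 * rSeq (k + 1) σ := by
  have h : ∀ i, stepSign (k + 1) σ i =
      1 - 2 * (if invAt (k + 1) σ (i + 1) < invAt (k + 1) σ i then (1 : ℝ) else 0) := by
    intro i
    unfold stepSign
    split_ifs <;> norm_num
  simp only [h, Finset.sum_sub_distrib, ← Finset.mul_sum, Finset.sum_boole, rSeq,
    Nat.add_sub_cancel]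
  simp
  ring

lemma stepSign_mul_le_one (n : ℕ) (σ : Equiv.Perm (Fin n)) (i j : ℕ) :
    stepSign n σ i * stepSign n σ j ≤ 1 := by
  unfold stepSign
  split_ifs <;> norm_num

lemma sum_stepSign_mul_eq_zero {k i j : ℕ} (hi : i < k)
    (hij : i + 1 < j ∨ j + 1 < i) :
    ∑ σ : Equiv.Perm (Fin (k + 1)), stepSign (k + 1) σ i * stepSign (k + 1) σ j = 0 := by
  set a : Fin (k + 1) := ⟨i, by omega⟩ with ha
  set b : Fin (k + 1) := ⟨i + 1, by omega⟩ with hb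
  set s : Equiv.Perm (Fin (k + 1)) := Equiv.swap a b with hs
  have hsinv : s⁻¹ = s := by rw [hs, Equiv.swap_inv]
  have h1 : ∀ σ, invAt (k + 1) (s * σ) i = invAt (k + 1) σ (i + 1) := fun σ => by
    simp only [invAt]
    rw [dif_pos (by omega), dif_pos (by omega), mul_inv_rev, hsinv, Equiv.Perm.mul_apply, hs, ← ha,
      Equiv.swap_apply_left]
  have h2 : ∀ σ, invAt (k + 1) (s * σ) (i + 1) = invAt (k + 1) σ i := fun σ => by
    simp only [invAt]
    rw [dif_pos (by omega), dif_pos (by omega), mul_inv_rev, hsinv, Equiv.Perm.mul_apply, hs, ← hb,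
      Equiv.swap_apply_right]
  have h3 : ∀ σ l, l ≠ i → l ≠ i + 1 → invAt (k + 1) (s * σ) l = invAt (k + 1) σ l := by
    intro σ l hl hl'
    simp only [invAt]
    split_ifs with h
    · rw [mul_inv_rev, hsinv, Equiv.Perm.mul_apply, hs, Equiv.swap_apply_of_ne_of_ne]
      · simpa [ha, Fin.ext_iff] using hl
      · simpa [hb, Fin.ext_iff] using hl'
    · rfl
  have h4 : ∀ σ : Equiv.Perm (Fin (k + 1)), invAt (k + 1) σ i ≠ invAt (k + 1) σ (i + 1) := by
    intro σ h
    simp only [invAt] at h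
    rw [dif_pos (by omega), dif_pos (by omega)] at h
    simpa using σ⁻¹.injective (Fin.ext h)
  have h5 : ∀ σ, stepSign (k + 1) (s * σ) i = - stepSign (k + 1) σ i := by
    intro σ
    have := h4 σ
    simp only [stepSign, h1, h2]
    split_ifs <;> first | omega | norm_num
  have h6 : ∀ σ, stepSign (k + 1) (s * σ) j = stepSign (k + 1) σ j := by
    intro σ
    simp only [stepSign]
    rw [h3 σ j (by omega) (by omega), h3 σ (j + 1) (by omega) (by omega)]
  have h7 := Equiv.sum_comp (Equiv.mulLeft s)
    (fun σ => stepSign (k + 1) σ i * stepSign (k + 1) σ j)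
  simp only [Equiv.coe_mulLeft, h5, h6, neg_mul, Finset.sum_neg_distrib] at h7
  linarith

/-- The centred number of rising sequences. -/
def rDev (n : ℕ) (σ : Equiv.Perm (Fin n)) : ℝ := ((n : ℝ) + 1) / 2 - rSeq n σ

lemma sum_rDev_sq_le (k : ℕ) :
    ∑ σ : Equiv.Perm (Fin (k + 1)), rDev (k + 1) σ ^ 2 ≤ (k + 1).factorial * (k + 1 : ℝ) := by
  have h1 : ∀ σ : Equiv.Perm (Fin (k + 1)), rDev (k + 1) σ ^ 2 =
      1 / 4 * ∑ i ∈ Finset.range k, ∑ j ∈ Finset.range k,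
        stepSign (k + 1) σ i * stepSign (k + 1) σ j := by
    intro σ
    rw [← Finset.sum_mul_sum, sum_stepSign, rDev]
    push_cast
    ring
  have h2 : ∀ i ∈ Finset.range k, ∀ j ∈ Finset.range k,
      ∑ σ : Equiv.Perm (Fin (k + 1)), stepSign (k + 1) σ i * stepSign (k + 1) σ j ≤
        if j ∈ ({i - 1, i, i + 1} : Finset ℕ) then ((k + 1).factorial : ℝ) else 0 := by
    intro i hi j hj
    split_ifs with h
    · refine (Finset.sum_le_sum fun σ _ => stepSign_mul_le_one _ σ i j).trans ?_
      simp [Fintype.card_perm]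
    · refine (sum_stepSign_mul_eq_zero (Finset.mem_range.1 hi) ?_).le
      simp only [Finset.mem_insert, Finset.mem_singleton] at h
      omega
  have h3 : ∀ i ∈ Finset.range k, ∑ j ∈ Finset.range k,
      (if j ∈ ({i - 1, i, i + 1} : Finset ℕ) then ((k + 1).factorial : ℝ) else 0) ≤
        3 * (k + 1).factorial := by
    intro i _
    rw [← Finset.sum_filter, Finset.sum_const, nsmul_eq_mul]
    gcongr
    have : ((Finset.range k).filter fun j => j ∈ ({i - 1, i, i + 1} : Finset ℕ)).card ≤ 3 :=
      (Finset.card_le_card (fun x hx => (Finset.mem_filter.1 hx).2)).trans Finset.card_le_three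
    exact_mod_cast this
  simp only [h1]
  rw [← Finset.mul_sum, Finset.sum_comm]
  have h4 : ∑ i ∈ Finset.range k, ∑ σ : Equiv.Perm (Fin (k + 1)), ∑ j ∈ Finset.range k,
      stepSign (k + 1) σ i * stepSign (k + 1) σ j ≤ k * (3 * (k + 1).factorial) := by
    calc _ ≤ ∑ i ∈ Finset.range k, (3 * ((k + 1).factorial : ℝ)) := by
          refine Finset.sum_le_sum fun i hi => ?_
          rw [Finset.sum_comm]
          exact (Finset.sum_le_sum fun j hj => h2 i hi j hj).trans (h3 i hi)
      _ = _ := by simp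
  have h5 : (0 : ℝ) < (k + 1).factorial := by positivity
  nlinarith [Nat.cast_nonneg (α := ℝ) k]

lemma rSeq_le (k : ℕ) (σ : Equiv.Perm (Fin (k + 1))) : rSeq (k + 1) σ ≤ k + 1 :=
  (Nat.le_add_right _ _).trans (rSeq_add_ascBefore k σ).le

lemma one_le_rSeq (n : ℕ) (σ : Equiv.Perm (Fin n)) : 1 ≤ rSeq n σ :=
  Nat.le_add_right _ _

/-- The likelihood ratio of the `m`-shuffle against the uniform distribution. -/
lemma factorial_mul_Qs {k m : ℕ} (hm : m ≠ 0) (σ : Equiv.Perm (Fin (k + 1))) :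
    ((k + 1).factorial : ℝ) * Qs (k + 1) m σ =
      ∏ i ∈ Finset.range (k + 1), (1 + ((k : ℝ) + 1 - rSeq (k + 1) σ - i) / m) := by
  have hm' : (m : ℝ) ≠ 0 := by exact_mod_cast hm
  have hr := rSeq_le k σ
  have h1 := Nat.descFactorial_eq_factorial_mul_choose (k + 1 + m - rSeq (k + 1) σ) (k + 1)
  have h2 := descPochhammer_eval_eq_descFactorial ℝ (k + 1 + m - rSeq (k + 1) σ) (k + 1)
  rw [descPochhammer_eval_eq_prod_range, h1, Nat.cast_mul, Nat.cast_sub (by omega)] at h2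
  have h3 : ((m : ℝ) ^ (k + 1))⁻¹ = ∏ _i ∈ Finset.range (k + 1), (m : ℝ)⁻¹ := by simp
  rw [Qs, mul_left_comm, ← h2, h3, ← Finset.prod_mul_distrib]
  refine Finset.prod_congr rfl fun i _ => ?_
  push_cast
  field_simp
  ring

lemma sum_range_sub_sq (n : ℕ) (c : ℝ) :
    ∑ i ∈ Finset.range n, ((i : ℝ) - c) ^ 2 =
      n * (n - 1) * (2 * n - 1) / 6 - c * n * (n - 1) + n * c ^ 2 := by
  induction n with
  | zero => simp
  | succ n ih => rw [Finset.sum_range_succ, ih]; push_cast; ring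

lemma sum_range_sub (n : ℕ) (c : ℝ) :
    ∑ i ∈ Finset.range n, (c - i) = n * c - n * (n - 1) / 2 := by
  induction n with
  | zero => simp
  | succ n ih => rw [Finset.sum_range_succ, ih]; push_cast; ring

lemma exp_sub_two_mul_sq_le {x : ℝ} (hx : |x| ≤ 1 / 2) : Real.exp (x - 2 * x ^ 2) ≤ 1 + x := by
  obtain ⟨h1, h2⟩ := abs_le.1 hx
  have h0 : 0 < 1 + x := by linarith
  rw [← Real.le_log_iff_exp_le h0]
  refine le_trans ?_ (Real.one_sub_inv_le_log_of_pos h0)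
  rw [← sub_nonneg]
  have : 1 - (1 + x)⁻¹ - (x - 2 * x ^ 2) = x ^ 2 * (1 + 2 * x) / (1 + x) := by
    field_simp
    ring
  rw [this]
  have : 0 ≤ 1 + 2 * x := by linarith
  positivity

lemma one_sub_le_factorial_mul_Qs {k m : ℕ} (hm : 2 * (k + 1) ≤ m)
    (σ : Equiv.Perm (Fin (k + 1))) :
    1 - (k + 1) * |rDev (k + 1) σ| / m - 2 * (k + 1 : ℝ) ^ 3 / m ^ 2 ≤
      ((k + 1).factorial : ℝ) * Qs (k + 1) m σ := by
  have hm0 : m ≠ 0 := by omega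
  have hmpos : (0 : ℝ) < m := by exact_mod_cast Nat.pos_of_ne_zero hm0
  have hm2 : 2 * ((k : ℝ) + 1) ≤ m := by exact_mod_cast hm
  have hr : (rSeq (k + 1) σ : ℝ) ≤ k + 1 := by exact_mod_cast rSeq_le k σ
  have hr1 : (1 : ℝ) ≤ rSeq (k + 1) σ := by exact_mod_cast one_le_rSeq _ σ
  rw [factorial_mul_Qs hm0]
  set r : ℝ := (rSeq (k + 1) σ : ℝ) with hr_def
  have habs : ∀ i ∈ Finset.range (k + 1), |((k : ℝ) + 1 - r - i) / m| ≤ (k + 1) / m := by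
    intro i hi
    have hi' : (i : ℝ) ≤ k := by exact_mod_cast Nat.lt_succ_iff.1 (Finset.mem_range.1 hi)
    have hi0 : (0 : ℝ) ≤ i := Nat.cast_nonneg i
    rw [abs_div, abs_of_pos hmpos]
    gcongr
    rw [abs_le]
    constructor <;> linarith
  have hhalf : ((k : ℝ) + 1) / m ≤ 1 / 2 := by
    rw [div_le_div_iff₀ hmpos two_pos]; linarith
  have hprod : Real.exp (∑ i ∈ Finset.range (k + 1),
      (((k : ℝ) + 1 - r - i) / m - 2 * (((k : ℝ) + 1 - r - i) / m) ^ 2)) ≤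
      ∏ i ∈ Finset.range (k + 1), (1 + ((k : ℝ) + 1 - r - i) / m) := by
    rw [Real.exp_sum]
    exact Finset.prod_le_prod (fun i _ => (Real.exp_pos _).le) fun i hi =>
      exp_sub_two_mul_sq_le ((habs i hi).trans hhalf)
  refine le_trans ?_ ((Real.add_one_le_exp _).trans hprod)
  rw [Finset.sum_sub_distrib, ← Finset.sum_div, sum_range_sub]
  have hsq : ∑ i ∈ Finset.range (k + 1), 2 * (((k : ℝ) + 1 - r - i) / m) ^ 2 ≤
      2 * (k + 1 : ℝ) ^ 3 / m ^ 2 := by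
    calc _ ≤ ∑ i ∈ Finset.range (k + 1), 2 * (((k : ℝ) + 1) / m) ^ 2 := by
          refine Finset.sum_le_sum fun i hi => ?_
          rw [← sq_abs]
          gcongr
          exact habs i hi
      _ = _ := by
          rw [Finset.sum_const, Finset.card_range, nsmul_eq_mul]
          push_cast
          field_simp
  have hlin : -((k + 1) * |rDev (k + 1) σ| / m) ≤
      (((k + 1 : ℕ) : ℝ) * ((k : ℝ) + 1 - r) -
        ((k + 1 : ℕ) : ℝ) * (((k + 1 : ℕ) : ℝ) - 1) / 2) / m := by
    have : (((k + 1 : ℕ) : ℝ) * ((k : ℝ) + 1 - r) -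
        ((k + 1 : ℕ) : ℝ) * (((k + 1 : ℕ) : ℝ) - 1) / 2) = (k + 1) * rDev (k + 1) σ := by
      rw [rDev, ← hr_def]; push_cast; ring
    rw [this, ← neg_div, ← mul_neg]
    gcongr
    exact neg_abs_le _
  linarith

lemma factorial_mul_Qs_sq_le {k m : ℕ} (hm : m ≠ 0) (σ : Equiv.Perm (Fin (k + 1))) :
    (((k + 1).factorial : ℝ) * Qs (k + 1) m σ) ^ 2 ≤
      Real.exp (2 * (k + 1) * rDev (k + 1) σ / m + (k + 1) * rDev (k + 1) σ ^ 2 / m ^ 2 -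
        (k + 1) * ((k + 1 : ℝ) ^ 2 - 1) / (12 * m ^ 2)) := by
  have hmpos : (0 : ℝ) < m := by exact_mod_cast Nat.pos_of_ne_zero hm
  rcases lt_or_ge m (rSeq (k + 1) σ) with hlt | hge
  · rw [Qs, Nat.choose_eq_zero_of_lt (by omega)]
    simpa using (Real.exp_pos _).le
  have hge' : (rSeq (k + 1) σ : ℝ) ≤ m := by exact_mod_cast hge
  have hD : (rSeq (k + 1) σ : ℝ) = (k + 2) / 2 - rDev (k + 1) σ := by
    rw [rDev]; push_cast; ring
  set D := rDev (k + 1) σ with hD_def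
  rw [factorial_mul_Qs hm]
  set f : ℕ → ℝ := fun i => 1 + ((k : ℝ) + 1 - rSeq (k + 1) σ - i) / m with hf
  have hfnonneg : ∀ i ∈ Finset.range (k + 1), 0 ≤ f i := by
    intro i hi
    have hi' : (i : ℝ) ≤ k := by exact_mod_cast Nat.lt_succ_iff.1 (Finset.mem_range.1 hi)
    have : f i = (m + k + 1 - rSeq (k + 1) σ - i) / m := by
      simp only [hf]; field_simp; ring
    rw [this]
    apply div_nonneg _ hmpos.le
    linarith
  have hpair : ∀ i ∈ Finset.range (k + 1), f i * f (k + 1 - 1 - i) ≤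
      Real.exp (2 * D / m + D ^ 2 / m ^ 2 - ((i : ℝ) - k / 2) ^ 2 / m ^ 2) := by
    intro i hi
    have hi' : i ≤ k := Nat.lt_succ_iff.1 (Finset.mem_range.1 hi)
    refine le_trans (le_of_eq ?_) (Real.add_one_le_exp _)
    simp only [hf, Nat.add_sub_cancel, Nat.cast_sub hi', hD]
    field_simp
    ring
  have hsq : (∏ i ∈ Finset.range (k + 1), f i) ^ 2 =
      ∏ i ∈ Finset.range (k + 1), f i * f (k + 1 - 1 - i) := by
    rw [Finset.prod_mul_distrib, Finset.prod_range_reflect, sq]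
  rw [hsq]
  refine (Finset.prod_le_prod (fun i hi => ?_) hpair).trans (le_of_eq ?_)
  · refine mul_nonneg (hfnonneg i hi) (hfnonneg _ ?_)
    rw [Finset.mem_range]; omega
  · rw [← Real.exp_sum, Finset.sum_sub_distrib, ← Finset.sum_div, sum_range_sub_sq,
      Finset.sum_const, Finset.card_range, nsmul_eq_mul]
    congr 1
    push_cast
    field_simp
    ring

lemma sum_Us (n : ℕ) : ∑ σ, Us n σ = 1 := by
  have : (n.factorial : ℝ) ≠ 0 := by positivity
  simp [Us, Fintype.card_perm, this]

lemma tv_nonneg (n : ℕ) (μ ν : Equiv.Perm (Fin n) → ℝ) : 0 ≤ tv n μ ν := by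
  unfold tv; positivity

lemma tv_eq_one_sub_sum_min (n : ℕ) (μ ν : Equiv.Perm (Fin n) → ℝ) (hμ : ∑ σ, μ σ = 1)
    (hν : ∑ σ, ν σ = 1) : tv n μ ν = 1 - ∑ σ, min (μ σ) (ν σ) := by
  have h : ∀ σ, |μ σ - ν σ| = μ σ + ν σ - 2 * min (μ σ) (ν σ) := by
    intro σ
    rcases le_total (μ σ) (ν σ) with h | h
    · rw [min_eq_left h, abs_of_nonpos (by linarith)]; ring
    · rw [min_eq_right h, abs_of_nonneg (by linarith)]; ring
  simp only [tv, h, Finset.sum_sub_distrib, Finset.sum_add_distrib, hμ, hν, ← Finset.mul_sum]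
  ring

lemma tv_Qs_le_one {k m : ℕ} (hm : m ≠ 0) : tv (k + 1) (Qs (k + 1) m) (Us (k + 1)) ≤ 1 := by
  rw [tv_eq_one_sub_sum_min _ _ _ (sum_Qs k m hm) (sum_Us _), sub_le_self_iff]
  refine Finset.sum_nonneg fun σ _ => le_min (Qs_nonneg _ _ _) ?_
  unfold Us; positivity

lemma sum_abs_rDev_le (k : ℕ) :
    ∑ σ : Equiv.Perm (Fin (k + 1)), |rDev (k + 1) σ| ≤
      (k + 1).factorial * Real.sqrt (k + 1) := by
  have h1 := sq_sum_le_card_mul_sum_sq (s := (Finset.univ : Finset (Equiv.Perm (Fin (k + 1)))))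
    (f := fun σ => |rDev (k + 1) σ|)
  simp only [sq_abs, Finset.card_univ, Fintype.card_perm, Fintype.card_fin] at h1
  have h2 := sum_rDev_sq_le k
  apply le_of_sq_le_sq _ (by positivity)
  rw [mul_pow, Real.sq_sqrt (by positivity)]
  calc _ ≤ _ := h1
    _ ≤ ((k + 1).factorial : ℝ) * ((k + 1).factorial * (k + 1 : ℝ)) := by gcongr
    _ = _ := by ring

/-- Closeness to uniform when `m` is much larger than `n ^ (3 / 2)`. -/
lemma tv_Qs_le {k m : ℕ} (hm : 2 * (k + 1) ≤ m) :
    tv (k + 1) (Qs (k + 1) m) (Us (k + 1)) ≤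
      (k + 1) * Real.sqrt (k + 1) / m + 2 * ((k + 1) * Real.sqrt (k + 1) / m) ^ 2 := by
  have hm0 : m ≠ 0 := by omega
  have hmpos : (0 : ℝ) < m := by exact_mod_cast Nat.pos_of_ne_zero hm0
  have hF : (0 : ℝ) < (k + 1).factorial := by positivity
  rw [tv_eq_one_sub_sum_min _ _ _ (sum_Qs k m hm0) (sum_Us _)]
  have hpt : ∀ σ : Equiv.Perm (Fin (k + 1)),
      ((k + 1).factorial : ℝ)⁻¹ *
        (1 - (k + 1) / m * |rDev (k + 1) σ| - 2 * (k + 1 : ℝ) ^ 3 / m ^ 2) ≤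
      min (Qs (k + 1) m σ) (Us (k + 1) σ) := by
    intro σ
    have h := one_sub_le_factorial_mul_Qs hm σ
    rw [mul_div_right_comm] at h
    refine le_min ?_ ?_
    · rwa [inv_mul_le_iff₀ hF]
    · rw [Us]
      refine mul_le_of_le_one_right (by positivity) ?_
      have h1 : 0 ≤ ((k : ℝ) + 1) / m * |rDev (k + 1) σ| := by positivity
      have h2 : 0 ≤ 2 * (k + 1 : ℝ) ^ 3 / m ^ 2 := by positivity
      linarith
  have hsum := Finset.sum_le_sum fun σ (_ : σ ∈ Finset.univ) => hpt σ
  rw [← Finset.mul_sum, Finset.sum_sub_distrib, Finset.sum_sub_distrib, ← Finset.mul_sum,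
    Finset.sum_const, Finset.sum_const, Finset.card_univ, Fintype.card_perm, Fintype.card_fin,
    nsmul_eq_mul, nsmul_eq_mul] at hsum
  have hD := mul_le_mul_of_nonneg_left (sum_abs_rDev_le k)
    (show 0 ≤ ((k + 1).factorial : ℝ)⁻¹ * (((k : ℝ) + 1) / m) by positivity)
  have e1 : ((k + 1).factorial : ℝ)⁻¹ * (((k : ℝ) + 1) / m) *
      ((k + 1).factorial * Real.sqrt (k + 1)) = (k + 1) * Real.sqrt (k + 1) / m := by
    field_simp
  have e2 : ((k + 1 : ℝ) * Real.sqrt (k + 1) / m) ^ 2 = (k + 1 : ℝ) ^ 3 / m ^ 2 := by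
    rw [div_pow, mul_pow, Real.sq_sqrt (by positivity)]; ring
  have e3 : ((k + 1).factorial : ℝ)⁻¹ * (((k + 1).factorial : ℝ) * 1 -
      (k + 1) / m * ∑ σ, |rDev (k + 1) σ| -
      ((k + 1).factorial : ℝ) * (2 * (k + 1 : ℝ) ^ 3 / m ^ 2)) =
      1 - ((k + 1).factorial : ℝ)⁻¹ * (((k : ℝ) + 1) / m) * ∑ σ, |rDev (k + 1) σ| -
        2 * ((k + 1 : ℝ) ^ 3 / m ^ 2) := by
    field_simp
  rw [e1] at hD
  rw [e3] at hsum
  rw [e2]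
  linarith

/-- Distance from uniform when `m` is much smaller than `n ^ (3 / 2)`. -/
lemma le_tv_Qs {k m : ℕ} (hk : 1 ≤ k) (hm : m ≠ 0) {K l : ℝ} (hK : 0 < K)
    (hl : l = (k + 1) * Real.sqrt (k + 1) / m) :
    1 - 1 / K ^ 2 - Real.exp (K * l + K ^ 2 * l ^ 2 / (2 * (k + 1)) - l ^ 2 / 48) ≤
      tv (k + 1) (Qs (k + 1) m) (Us (k + 1)) := by
  have hmpos : (0 : ℝ) < m := by exact_mod_cast Nat.pos_of_ne_zero hm
  have hF : (0 : ℝ) < (k + 1).factorial := by positivity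
  have hk' : (1 : ℝ) ≤ k := by exact_mod_cast hk
  have hl2 : l ^ 2 = (k + 1 : ℝ) ^ 3 / m ^ 2 := by
    rw [hl, div_pow, mul_pow, Real.sq_sqrt (by positivity)]; ring
  rw [tv_eq_one_sub_sum_min _ _ _ (sum_Qs k m hm) (sum_Us _)]
  set E := Real.exp (K * l + K ^ 2 * l ^ 2 / (2 * (k + 1)) - l ^ 2 / 48) with hE
  have hpt : ∀ σ : Equiv.Perm (Fin (k + 1)), min (Qs (k + 1) m σ) (Us (k + 1) σ) ≤
      ((k + 1).factorial : ℝ)⁻¹ * (1 / (K ^ 2 * (k + 1)) * rDev (k + 1) σ ^ 2 + E) := by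
    intro σ
    have hEpos : 0 < E := Real.exp_pos _
    rcases le_or_gt (rDev (k + 1) σ ^ 2) (K ^ 2 * (k + 1)) with h | h
    · refine (min_le_left _ _).trans ?_
      rw [← mul_le_mul_iff_right₀ hF, mul_inv_cancel_left₀ hF.ne']
      have h1 := factorial_mul_Qs_sq_le hm σ
      have h2 : rDev (k + 1) σ ≤ K * Real.sqrt (k + 1) := by
        apply le_of_sq_le_sq _ (by positivity)
        rwa [mul_pow, Real.sq_sqrt (by positivity)]
      have h3 : (((k + 1).factorial : ℝ) * Qs (k + 1) m σ) ^ 2 ≤ E ^ 2 := by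
        refine h1.trans ?_
        rw [hE, ← Real.exp_nat_mul]
        apply Real.exp_le_exp.2
        have a1 : 2 * (k + 1) * rDev (k + 1) σ / m ≤ 2 * (K * l) := by
          have : 2 * (K * l) = 2 * (k + 1) * (K * Real.sqrt (k + 1)) / m := by rw [hl]; ring
          rw [this]
          gcongr
        have a2 : (k + 1) * rDev (k + 1) σ ^ 2 / m ^ 2 ≤
            2 * (K ^ 2 * l ^ 2 / (2 * (k + 1))) := by
          have : 2 * (K ^ 2 * l ^ 2 / (2 * (k + 1))) = (k + 1) * (K ^ 2 * (k + 1)) / m ^ 2 := by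
            rw [hl2]; field_simp
          rw [this]
          gcongr
        have a3 : 2 * (l ^ 2 / 48) ≤ (k + 1) * ((k + 1 : ℝ) ^ 2 - 1) / (12 * m ^ 2) := by
          have : 2 * (l ^ 2 / 48) = (k + 1) * ((k + 1 : ℝ) ^ 2 / 2) / (12 * m ^ 2) := by
            rw [hl2]; field_simp; norm_num
          rw [this]
          gcongr
          nlinarith
        push_cast
        linarith
      have h4 := le_of_sq_le_sq h3 hEpos.le
      have h5 : 0 ≤ 1 / (K ^ 2 * (k + 1)) * rDev (k + 1) σ ^ 2 := by positivity
      linarith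
    · refine (min_le_right _ _).trans ?_
      rw [Us]
      refine le_mul_of_one_le_right (by positivity) ?_
      have : 1 ≤ 1 / (K ^ 2 * (k + 1)) * rDev (k + 1) σ ^ 2 := by
        rw [one_div_mul_eq_div, one_le_div (by positivity)]
        exact h.le
      linarith
  have hsum := Finset.sum_le_sum fun σ (_ : σ ∈ Finset.univ) => hpt σ
  rw [← Finset.mul_sum, Finset.sum_add_distrib, ← Finset.mul_sum,
    Finset.sum_const, Finset.card_univ, Fintype.card_perm, Fintype.card_fin,
    nsmul_eq_mul] at hsum
  have hD := mul_le_mul_of_nonneg_left (sum_rDev_sq_le k)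
    (show 0 ≤ ((k + 1).factorial : ℝ)⁻¹ * (1 / (K ^ 2 * (k + 1))) by positivity)
  have e1 : ((k + 1).factorial : ℝ)⁻¹ * (1 / (K ^ 2 * (k + 1))) *
      ((k + 1).factorial * (k + 1 : ℝ)) = 1 / K ^ 2 := by
    field_simp
  have e2 : ((k + 1).factorial : ℝ)⁻¹ * (1 / (K ^ 2 * (k + 1)) * ∑ σ, rDev (k + 1) σ ^ 2 +
      ((k + 1).factorial : ℝ) * E) =
      ((k + 1).factorial : ℝ)⁻¹ * (1 / (K ^ 2 * (k + 1))) * ∑ σ, rDev (k + 1) σ ^ 2 + E := by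
    field_simp
  rw [e1] at hD
  rw [e2] at hsum
  linarith

lemma exists_one_sub_le_tv_Qs {ε : ℝ} (hε : 0 < ε) :
    ∃ (L : ℝ) (N : ℕ), 0 < L ∧ ∀ k m : ℕ, N ≤ k → m ≠ 0 →
      L ^ 2 * (m : ℝ) ^ 2 ≤ (k + 1 : ℝ) ^ 3 →
      1 - ε ≤ tv (k + 1) (Qs (k + 1) m) (Us (k + 1)) := by
  set K : ℝ := 1 + 2 / ε with hK
  have hKpos : 0 < K := by positivity
  have hKinv : 1 / K ^ 2 ≤ ε / 2 := by
    rw [div_le_div_iff₀ (by positivity) two_pos]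
    have : ε * K ^ 2 = ε + 4 + 4 / ε := by rw [hK]; field_simp; ring
    rw [this]
    have : 0 < 4 / ε := by positivity
    linarith
  obtain ⟨N, hN⟩ := exists_nat_ge (48 * K ^ 2)
  refine ⟨96 * (K + 1) + 2 / ε, max N 1, by positivity, fun k m hk hm h => ?_⟩
  have hmpos : (0 : ℝ) < m := by exact_mod_cast Nat.pos_of_ne_zero hm
  have hk1 : 1 ≤ k := (le_max_right _ _).trans hk
  have hkN : (N : ℝ) ≤ k := by exact_mod_cast (le_max_left _ _).trans hk
  set l : ℝ := (k + 1) * Real.sqrt (k + 1) / m with hl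
  have hl2 : l ^ 2 = (k + 1 : ℝ) ^ 3 / m ^ 2 := by
    rw [hl, div_pow, mul_pow, Real.sq_sqrt (by positivity)]; ring
  have hLl : 96 * (K + 1) + 2 / ε ≤ l := by
    apply le_of_sq_le_sq _ (by positivity)
    rw [hl2, le_div_iff₀ (by positivity)]
    exact h
  have h2ε : 0 < 2 / ε := by positivity
  have hlpos : 0 < l := by linarith
  refine le_trans ?_ (le_tv_Qs hk1 hm hKpos hl)
  have hexp : Real.exp (K * l + K ^ 2 * l ^ 2 / (2 * (k + 1)) - l ^ 2 / 48) ≤ ε / 2 := by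
    have h1 : K ^ 2 * l ^ 2 / (2 * (k + 1)) ≤ l ^ 2 / 96 := by
      rw [div_le_div_iff₀ (by positivity) (by norm_num)]
      nlinarith [sq_nonneg l]
    have h2 : K * l + K ^ 2 * l ^ 2 / (2 * (k + 1)) - l ^ 2 / 48 ≤ -l := by
      nlinarith
    refine (Real.exp_le_exp.2 h2).trans ?_
    rw [Real.exp_neg]
    apply inv_le_of_inv_le₀ (by positivity)
    rw [inv_div]
    have := Real.add_one_le_exp l
    linarith
  linarith

lemma tv_Qs_le_of_sq_le {k m : ℕ} {δ : ℝ} (hδ : 0 < δ) (hδ' : δ ≤ 1 / 2) (hm : m ≠ 0)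
    (h : (k + 1 : ℝ) ^ 3 ≤ δ ^ 2 * (m : ℝ) ^ 2) :
    tv (k + 1) (Qs (k + 1) m) (Us (k + 1)) ≤ 2 * δ := by
  have hmpos : (0 : ℝ) < m := by exact_mod_cast Nat.pos_of_ne_zero hm
  set l : ℝ := (k + 1) * Real.sqrt (k + 1) / m with hl
  have hl2 : l ^ 2 = (k + 1 : ℝ) ^ 3 / m ^ 2 := by
    rw [hl, div_pow, mul_pow, Real.sq_sqrt (by positivity)]; ring
  have hl0 : 0 ≤ l := by positivity
  have hlδ : l ≤ δ := by
    apply le_of_sq_le_sq _ hδ.le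
    rwa [hl2, div_le_iff₀ (by positivity)]
  have hm2 : 2 * (k + 1) ≤ m := by
    have : (2 * (k + 1) : ℝ) ≤ m := by
      apply le_of_sq_le_sq _ hmpos.le
      have h0 : (0 : ℝ) ≤ k := Nat.cast_nonneg k
      have h1 : δ ^ 2 ≤ 1 / 4 := by nlinarith
      have h2 : δ ^ 2 * (m : ℝ) ^ 2 ≤ 1 / 4 * m ^ 2 := by gcongr
      nlinarith [mul_nonneg h0 (sq_nonneg (k + 1 : ℝ))]
    exact_mod_cast this
  refine (tv_Qs_le hm2).trans ?_
  rw [← hl]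
  nlinarith

lemma curly_pos (t : ℝ) : 0 < curly t := by
  unfold curly
  split_ifs with h
  · norm_num
  · have : 1 ≤ round t := by
      rw [round_eq, Int.le_floor]
      push_cast
      linarith
    exact_mod_cast this

lemma eq_zero_or_le_of_lt_curly {t : ℝ} {j : ℕ} (h : (j : ℝ) < curly t) :
    j = 0 ∨ (j : ℝ) + 1 / 2 ≤ t := by
  unfold curly at h
  split_ifs at h with ht
  · left
    have : (j : ℝ) < 1 := by linarith
    exact_mod_cast Nat.lt_one_iff.1 (by exact_mod_cast this)
  · right
    have h1 : (j : ℤ) + 1 ≤ round t := by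
      have : (j : ℤ) < round t := by exact_mod_cast h
      omega
    rw [round_eq, Int.le_floor] at h1
    push_cast at h1
    linarith

lemma add_half_le_of_curly_lt {t : ℝ} {j : ℕ} (h : curly t < (j : ℝ)) : t + 1 / 2 ≤ j := by
  unfold curly at h
  split_ifs at h with ht
  · have : 1 ≤ j := by
      by_contra! hj
      have : j = 0 := by omega
      subst this
      norm_num at h
    have : (1 : ℝ) ≤ j := by exact_mod_cast this
    linarith
  · have h1 : round t < (j : ℤ) := by exact_mod_cast h
    rw [round_eq, Int.floor_lt] at h1
    push_cast at h1
    linarith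

/-- If `m_n → ∞`, there is a `({t_n}, b_n)` cutoff for any `b_n = o(1)`:
the total variation distance tends to `1` below `{t_n}` and to `0` above `{t_n}`. -/
theorem m_shuffle_sharp_cutoff (m : ℕ → ℕ) (hm : ∀ n, 2 ≤ m n)
    (hm' : Filter.Tendsto m Filter.atTop Filter.atTop) :
    Filter.Tendsto (fun n : ℕ =>
      sInf {x : ℝ | ∃ k : ℕ, (k : ℝ) < curly (3 * Real.log n / (2 * Real.log (m n))) ∧
        x = tv n (iterConv n (Qs n (m n)) k) (Us n)}) Filter.atTop (nhds 1) ∧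
    Filter.Tendsto (fun n : ℕ =>
      sSup {x : ℝ | ∃ k : ℕ, curly (3 * Real.log n / (2 * Real.log (m n))) < (k : ℝ) ∧
        x = tv n (iterConv n (Qs n (m n)) k) (Us n)}) Filter.atTop (nhds 0) := by
  have hm0 : ∀ n j, m n ^ j ≠ 0 := fun n j => pow_ne_zero _ (by have := hm n; omega)
  have hlog : ∀ n, 0 < Real.log (m n) := fun n =>
    Real.log_pos (by exact_mod_cast lt_of_lt_of_le one_lt_two (hm n))
  have hmR : ∀ n, (0 : ℝ) < m n := fun n => by have := hm n; positivity
  have hmTop : Tendsto (fun n => (m n : ℝ)) atTop atTop := tendsto_natCast_atTop_atTop.comp hm'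
  constructor
  · rw [Metric.tendsto_atTop']
    intro ε hε
    obtain ⟨L, N, hL, hLN⟩ := exists_one_sub_le_tv_Qs (half_pos hε)
    obtain ⟨N1, hN1⟩ := eventually_atTop.1 (hmTop.eventually_ge_atTop (L ^ 2))
    obtain ⟨N2, hN2⟩ := exists_nat_ge (L ^ 2)
    refine ⟨N + N1 + N2, fun n hn => ?_⟩
    obtain ⟨k, rfl⟩ : ∃ k, n = k + 1 := ⟨n - 1, by omega⟩
    simp only [iterConv_Qs]
    set t : ℝ := 3 * Real.log ((k + 1 : ℕ) : ℝ) / (2 * Real.log (m (k + 1))) with ht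
    have hmL : L ^ 2 ≤ m (k + 1) := hN1 _ (by omega)
    have hkL : L ^ 2 ≤ (k : ℝ) := hN2.trans (by exact_mod_cast (by omega : N2 ≤ k))
    have hlow : ∀ x ∈ {x : ℝ | ∃ j : ℕ, (j : ℝ) < curly t ∧
        x = tv (k + 1) (Qs (k + 1) (m (k + 1) ^ j)) (Us (k + 1))}, 1 - ε / 2 ≤ x := by
      rintro x ⟨j, hj, rfl⟩
      refine hLN k _ (by omega) (hm0 _ _) ?_
      rcases eq_zero_or_le_of_lt_curly hj with rfl | hj'
      · have h0 : (0 : ℝ) ≤ k := Nat.cast_nonneg k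
        have h1 : (k : ℝ) ≤ (k + 1) ^ 3 := by nlinarith [mul_nonneg h0 h0, pow_nonneg h0 3]
        simp only [pow_zero, Nat.cast_one, one_pow, mul_one]
        linarith
      · have h1 : ((2 * j + 1 : ℕ) : ℝ) * Real.log (m (k + 1)) ≤
            ((3 : ℕ) : ℝ) * Real.log ((k + 1 : ℕ) : ℝ) := by
          rw [ht, le_div_iff₀ (by have := hlog (k + 1); positivity)] at hj'
          push_cast at hj' ⊢
          linarith
        rw [← Real.log_pow, ← Real.log_pow,
          Real.log_le_log_iff (by have := hmR (k + 1); positivity) (by positivity)] at h1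
        push_cast at h1 ⊢
        refine le_trans ?_ h1
        rw [pow_succ (m (k + 1) : ℝ) (2 * j), pow_mul', mul_comm]
        gcongr
    have hmem : tv (k + 1) (Qs (k + 1) (m (k + 1) ^ 0)) (Us (k + 1)) ∈
        {x : ℝ | ∃ j : ℕ, (j : ℝ) < curly t ∧
          x = tv (k + 1) (Qs (k + 1) (m (k + 1) ^ j)) (Us (k + 1))} :=
      ⟨0, by simpa using curly_pos t, rfl⟩
    have h1 := le_csInf ⟨_, hmem⟩ hlow
    have h2 := (csInf_le ⟨_, hlow⟩ hmem).trans (tv_Qs_le_one (hm0 _ _))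
    rw [Real.dist_eq, abs_lt]
    constructor <;> linarith
  · rw [Metric.tendsto_atTop']
    intro ε hε
    set δ : ℝ := min (1 / 2) (ε / 4) with hδ_def
    have hδ : 0 < δ := by positivity
    obtain ⟨N1, hN1⟩ := eventually_atTop.1 (hmTop.eventually_ge_atTop (1 / δ ^ 2))
    refine ⟨N1, fun n hn => ?_⟩
    obtain ⟨k, rfl⟩ : ∃ k, n = k + 1 := ⟨n - 1, by omega⟩
    simp only [iterConv_Qs]
    set t : ℝ := 3 * Real.log ((k + 1 : ℕ) : ℝ) / (2 * Real.log (m (k + 1))) with ht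
    have hmδ : 1 / δ ^ 2 ≤ m (k + 1) := hN1 _ (by omega)
    have hup : ∀ x ∈ {x : ℝ | ∃ j : ℕ, curly t < (j : ℝ) ∧
        x = tv (k + 1) (Qs (k + 1) (m (k + 1) ^ j)) (Us (k + 1))}, x ≤ 2 * δ := by
      rintro x ⟨j, hj, rfl⟩
      refine tv_Qs_le_of_sq_le hδ (min_le_left _ _) (hm0 _ _) ?_
      have hj' := add_half_le_of_curly_lt hj
      have h1 : ((3 : ℕ) : ℝ) * Real.log ((k + 1 : ℕ) : ℝ) + Real.log (m (k + 1)) ≤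
          ((2 * j : ℕ) : ℝ) * Real.log (m (k + 1)) := by
        rw [ht, ← le_sub_iff_add_le, div_le_iff₀ (by have := hlog (k + 1); positivity)] at hj'
        push_cast at hj' ⊢
        linarith
      rw [← Real.log_pow, ← Real.log_pow, ← Real.log_mul (by positivity) (hmR (k + 1)).ne',
        Real.log_le_log_iff (by have := hmR (k + 1); positivity)
          (by have := hmR (k + 1); positivity)] at h1
      rw [div_le_iff₀ (by positivity)] at hmδ
      push_cast at h1 ⊢
      rw [← pow_mul, mul_comm j 2]
      calc (k + 1 : ℝ) ^ 3 ≤ (k + 1 : ℝ) ^ 3 * (m (k + 1) * δ ^ 2) :=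
            le_mul_of_one_le_right (by positivity) hmδ
        _ = δ ^ 2 * ((k + 1 : ℝ) ^ 3 * m (k + 1)) := by ring
        _ ≤ _ := by gcongr
    have h1 := Real.sSup_le hup (by positivity)
    have h2 : 0 ≤ sSup {x : ℝ | ∃ j : ℕ, curly t < (j : ℝ) ∧
        x = tv (k + 1) (Qs (k + 1) (m (k + 1) ^ j)) (Us (k + 1))} :=
      Real.sSup_nonneg (by rintro x ⟨j, -, rfl⟩; exact tv_nonneg _ _ _)
    have h3 : δ ≤ ε / 4 := min_le_right _ _
    rw [Real.dist_eq, sub_zero, abs_of_nonneg h2]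
    linarith
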